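/- arXiv:1211.6066 — 2 statements merged into one kernel-verified Lean document; each statement's English description precedes it below -/
import Mathlib

section
/- For all integers n ≥ 1, r ≥ 1 and all non-negative integers x₁,…,x_r: Σ_{p₁,…,p_r ≥ 1} k^n_{p₁,…,p_r} · Π_{i=1}^r x_i^{p_i} = Σ_{p₁,…,p_r ≥ 1} |C^n(p₁,…,p_r)| · Π_{i=1}^r (x_i)_{p_i}, where (x)_p = x(x−1)⋯(x−p+1) denotes the falling factorial. -/
open Finset

/-- The number of cycles (orbits, fixed points included) of a permutation of `Fin n`. -/
def cycleCount {n : ℕ} (α : Equiv.Perm (Fin n)) : ℕ :=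
  (Equiv.Perm.partition α).parts.card

/-- `numFactorizations n r p` is the number `k^n_{p₁,…,p_r}` of `r`-tuples of permutations
of `{1,…,n}` whose (left-to-right) product is the long cycle `(1 2 … n)` and whose `i`-th
component has exactly `p i` cycles. -/
noncomputable def numFactorizations (n r : ℕ) (p : Fin r → ℕ) : ℕ :=
  Nat.card {α : Fin r → Equiv.Perm (Fin n) //
    (List.ofFn α).prod = finRotate n ∧ ∀ i, cycleCount (α i) = p i}

/-- The set `C^n(p₁,…,p_r)` of partitioned factorizations: `2r`-tuples
`(α₁,…,α_r, π₁,…,π_r)` where the `α_i` are permutations of `{1,…,n}` with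
`α₁α₂⋯α_r = γ_n` and each `π_i` is a set partition of `{1,…,n}` into exactly `p i`
blocks, each block being invariant under `α_i`. -/
def PartitionedCacti (n r : ℕ) (p : Fin r → ℕ) : Type :=
  {c : (Fin r → Equiv.Perm (Fin n)) × (Fin r → Finpartition (Finset.univ : Finset (Fin n))) //
    (List.ofFn c.1).prod = finRotate n ∧
    (∀ i, (c.2 i).parts.card = p i) ∧
    ∀ i : Fin r, ∀ b ∈ (c.2 i).parts, ∀ v ∈ b, c.1 i v ∈ b}

/-- A finite sum over the values of a statistic, weighted by the sizes of its fibres, is a sum over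
the underlying objects. -/
theorem finsum_card_fiber_mul {T ι : Type*} [Fintype T] (S : T → Prop) [DecidablePred S]
    (f : T → ι) (P : ι → Prop) (hP : ∀ t, S t → P (f t)) (G : ι → ℕ) :
    ∑ᶠ (p : ι) (_ : P p), Nat.card {t // S t ∧ f t = p} * G p
      = ∑ t with S t, G (f t) := by
  classical
  have hval (p : ι) : (∑ᶠ (_ : P p), Nat.card {t // S t ∧ f t = p} * G p)
      = ∑ t with S t ∧ f t = p, G (f t) := by
    have hcard : ∑ t with S t ∧ f t = p, G (f t) = Nat.card {t // S t ∧ f t = p} * G p := by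
      rw [Nat.card_eq_fintype_card, Fintype.card_subtype,
        Finset.sum_congr rfl (g := fun _ ↦ G p), Finset.sum_const, smul_eq_mul]
      intro t ht
      rw [(Finset.mem_filter.mp ht).2.2]
    by_cases hp : P p
    · rw [finsum_eq_if, if_pos hp, hcard]
    · rw [finsum_eq_if, if_neg hp, eq_comm]
      refine Finset.sum_eq_zero fun t ht ↦ ?_
      obtain ⟨-, hS, rfl⟩ := Finset.mem_filter.mp ht
      exact absurd (hP t hS) hp
  simp_rw [hval]
  rw [finsum_eq_sum_of_support_subset (s := (Finset.univ.filter S).image f)]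
  · rw [← Finset.sum_fiberwise_of_maps_to
      (fun t ht ↦ Finset.mem_image_of_mem f ht : ∀ t ∈ Finset.univ.filter S, f t ∈ _)]
    exact Finset.sum_congr rfl fun p _ ↦ by rw [Finset.filter_filter]
  · intro p hp
    obtain ⟨t, ht, -⟩ := Finset.exists_ne_zero_of_sum_ne_zero hp
    obtain ⟨-, hS, rfl⟩ := Finset.mem_filter.mp ht
    simpa using ⟨t, hS, rfl⟩

/-- The cycle of `v` under `σ`: a cycle factor of `σ`, or `v` itself when it is fixed. -/
def Equiv.Perm.cycleOrFixedPoint {α : Type*} [Fintype α] [DecidableEq α] (σ : Equiv.Perm α)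
    (v : α) : σ.cycleFactorsFinset ⊕ {v // σ v = v} :=
  if h : σ v = v then .inr ⟨v, h⟩
  else .inl ⟨σ.cycleOf v, by simpa [Equiv.Perm.cycleOf_mem_cycleFactorsFinset_iff] using h⟩

theorem Equiv.Perm.cycleOrFixedPoint_surjective {α : Type*} [Fintype α] [DecidableEq α]
    (σ : Equiv.Perm α) : Function.Surjective σ.cycleOrFixedPoint := by
  rintro (⟨c, hc⟩ | ⟨v, hv⟩)
  · obtain ⟨v, hv⟩ := (Equiv.Perm.mem_cycleFactorsFinset_iff.mp hc).1.nonempty_support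
    have hσ : σ v ≠ v :=
      Equiv.Perm.mem_support.mp (Equiv.Perm.mem_cycleFactorsFinset_support_le hc hv)
    refine ⟨v, ?_⟩
    simp [cycleOrFixedPoint, hσ, Equiv.Perm.cycle_is_cycleOf hv hc]
  · exact ⟨v, by simp [cycleOrFixedPoint, hv]⟩

theorem Equiv.Perm.cycleOrFixedPoint_eq_iff {α : Type*} [Fintype α] [DecidableEq α]
    (σ : Equiv.Perm α) (v w : α) :
    σ.cycleOrFixedPoint v = σ.cycleOrFixedPoint w ↔ σ.SameCycle v w := by
  by_cases hv : σ v = v <;> by_cases hw : σ w = w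
  · simpa [cycleOrFixedPoint, hv, hw] using
      ⟨fun h ↦ h ▸ .refl σ v, fun h ↦ h.eq_of_left hv⟩
  · simpa [cycleOrFixedPoint, hv, hw] using fun h ↦ hw (h.apply_eq_self_iff.mp hv)
  · simpa [cycleOrFixedPoint, hv, hw] using fun h ↦ hv (h.apply_eq_self_iff.mpr hw)
  · simpa [cycleOrFixedPoint, hv, hw] using
      (Equiv.Perm.sameCycle_iff_cycleOf_eq_of_mem_support
        (Equiv.Perm.mem_support.mpr hv) (Equiv.Perm.mem_support.mpr hw)).symm

theorem card_quotient_sameCycle {n : ℕ} (σ : Equiv.Perm (Fin n)) :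
    Nat.card (Quotient (Equiv.Perm.SameCycle.setoid σ)) = cycleCount σ := by
  have hker : Equiv.Perm.SameCycle.setoid σ = Setoid.ker σ.cycleOrFixedPoint :=
    Setoid.ext fun v w ↦ (σ.cycleOrFixedPoint_eq_iff v w).symm
  rw [hker, Nat.card_congr (Setoid.quotientKerEquivOfSurjective _ σ.cycleOrFixedPoint_surjective),
    Nat.card_sum, cycleCount, Equiv.Perm.parts_partition, Multiset.card_add,
    Multiset.card_replicate, Equiv.Perm.cycleType_def, Multiset.card_map, Nat.card_eq_fintype_card,
    Fintype.card_coe, Finset.card_val, ← Finset.card_compl, Nat.card_eq_fintype_card,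
    Fintype.card_subtype]
  congr 2
  ext v
  simp

/-- Colourings constant along `σ` are colourings of the cycles of `σ`. -/
theorem card_invariant_functions {n : ℕ} (σ : Equiv.Perm (Fin n)) (x : ℕ) :
    #{f : Fin n → Fin x | ∀ v, f (σ v) = f v} = x ^ cycleCount σ := by
  classical
  have hzpow (f : Fin n → Fin x) (hf : ∀ v, f (σ v) = f v) (v w : Fin n)
      (h : σ.SameCycle v w) : f v = f w := by
    obtain ⟨k, -, -, rfl⟩ := h.exists_pow_eq
    clear h
    induction k with
    | zero => rfl
    | succ k ih => rw [pow_succ', Equiv.Perm.mul_apply, hf]; exact ih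
  let e : {f : Fin n → Fin x // ∀ v, f (σ v) = f v} ≃
      (Quotient (Equiv.Perm.SameCycle.setoid σ) → Fin x) :=
    { toFun f := Quotient.lift f.1 (hzpow f.1 f.2)
      invFun g := ⟨fun v ↦ g (Quotient.mk _ v), fun v ↦ congrArg g <| Quotient.sound <|
        Equiv.Perm.sameCycle_apply_left.mpr (.refl σ v)⟩
      left_inv _ := rfl
      right_inv g := by
        ext q
        induction q using Quotient.inductionOn
        rfl }
  rw [← Fintype.card_subtype, ← Nat.card_eq_fintype_card, Nat.card_congr e, Nat.card_fun,
    card_quotient_sameCycle, Nat.card_fin]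

section Finpartition

variable {α β : Type*} [Fintype α] [DecidableEq α] [DecidableEq β]

/-- The partition of a finite type into the nonempty fibres of a function. -/
def Finpartition.ker (f : α → β) : Finpartition (univ : Finset α) :=
  letI : DecidableRel (Setoid.ker f).r := fun v w ↦ decEq (f v) (f w)
  Finpartition.ofSetoid (Setoid.ker f)

theorem Finpartition.mem_part_ker_iff (f : α → β) (v w : α) :
    w ∈ (Finpartition.ker f).part v ↔ f v = f w :=
  letI : DecidableRel (Setoid.ker f).r := fun v w ↦ decEq (f v) (f w)
  Finpartition.mem_part_ofSetoid_iff_rel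

theorem Finpartition.ker_eq_iff (f : α → β) (π : Finpartition (univ : Finset α)) :
    Finpartition.ker f = π ↔ ∀ v w, f v = f w ↔ π.part v = π.part w := by
  constructor
  · rintro rfl v w
    rw [← Finpartition.mem_part_iff_part_eq_part _ (mem_univ v) (mem_univ w),
      Finpartition.mem_part_ker_iff, eq_comm]
  · intro h
    have hpart (v : α) : (Finpartition.ker f).part v = π.part v := by
      ext w
      rw [Finpartition.mem_part_ker_iff, h,
        Finpartition.mem_part_iff_part_eq_part _ (mem_univ w) (mem_univ v), eq_comm]
    have hparts (ρ : Finpartition (univ : Finset α)) : ρ.parts = univ.image ρ.part := by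
      ext b
      constructor
      · intro hb
        obtain ⟨v, hv, rfl⟩ := ρ.part_surjOn hb
        exact mem_image_of_mem _ (mem_univ v)
      · intro hb
        obtain ⟨v, hv, rfl⟩ := mem_image.mp hb
        exact ρ.part_mem.mpr hv
    ext1
    rw [hparts, hparts π, funext hpart]

/-- Functions whose fibres are the parts of `π` are injective functions on the parts. -/
theorem card_functions_with_ker [Fintype β] (π : Finpartition (univ : Finset α)) :
    #{f : α → β | Finpartition.ker f = π}
      = (Fintype.card β).descFactorial #π.parts := by
  let partOf (v : α) : π.parts := ⟨π.part v, π.part_mem.mpr (mem_univ v)⟩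
  have hsurj : Function.Surjective partOf := fun ⟨b, hb⟩ ↦ by
    obtain ⟨v, -, hv⟩ := π.part_surjOn hb
    exact ⟨v, Subtype.ext hv⟩
  have hpart (v w : α) : partOf v = partOf w ↔ π.part v = π.part w := Subtype.ext_iff
  let Φ (e : π.parts ↪ β) : {f : α → β // Finpartition.ker f = π} :=
    ⟨e ∘ partOf, (Finpartition.ker_eq_iff _ _).mpr fun v w ↦ by simp [hpart]⟩
  have hΦ : Function.Bijective Φ := by
    constructor
    · intro e e' h
      exact DFunLike.coe_injective (hsurj.injective_comp_right (congrArg Subtype.val h))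
    · rintro ⟨f, hf⟩
      rw [Finpartition.ker_eq_iff] at hf
      have hsec := Function.surjInv_eq hsurj
      refine ⟨⟨fun b ↦ f (Function.surjInv hsurj b), fun b c hbc ↦ ?_⟩, ?_⟩
      · rw [← hsec b, ← hsec c, hpart]
        exact (hf _ _).mp hbc
      · ext v
        exact (hf _ _).mpr ((hpart _ _).mp (hsec _))
  rw [← Fintype.card_subtype, ← Fintype.card_of_bijective hΦ, Fintype.card_embedding_eq,
    Fintype.card_coe]

theorem invariant_ker_iff (σ : Equiv.Perm α) (f : α → β) :
    (∀ b ∈ (Finpartition.ker f).parts, ∀ v ∈ b, σ v ∈ b)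
      ↔ ∀ v, f (σ v) = f v := by
  constructor
  · intro h v
    have := h _ (Finpartition.part_mem _ |>.mpr (mem_univ v)) v
      (Finpartition.mem_part _ (mem_univ v))
    rw [Finpartition.mem_part_ker_iff] at this
    exact this.symm
  · intro h b hb v hv
    rw [← Finpartition.part_eq_of_mem _ hb hv, Finpartition.mem_part_ker_iff]
    exact (h v).symm

end Finpartition

theorem pow_cycleCount_eq_sum_descFactorial {n : ℕ} (σ : Equiv.Perm (Fin n)) (x : ℕ) :
    x ^ cycleCount σ = ∑ π : Finpartition (univ : Finset (Fin n))
      with ∀ b ∈ π.parts, ∀ v ∈ b, σ v ∈ b, x.descFactorial #π.parts := by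
  rw [← card_invariant_functions, card_eq_sum_card_fiberwise
    (f := fun f : Fin n → Fin x ↦ Finpartition.ker f)
    (t := {π | ∀ b ∈ π.parts, ∀ v ∈ b, σ v ∈ b})]
  · refine sum_congr rfl fun π hπ ↦ ?_
    rw [filter_filter]
    have h := card_functions_with_ker (β := Fin x) π
    rw [Fintype.card_fin] at h
    rw [← h]
    congr 1
    refine filter_congr fun f _ ↦ and_iff_right_of_imp ?_
    rintro rfl
    exact (invariant_ker_iff σ f).mp (mem_filter.mp hπ).2
  · intro f hf
    simp only [coe_filter, mem_univ, true_and, Set.mem_ofPred_eq] at hf ⊢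
    exact (invariant_ker_iff σ f).mpr hf

theorem one_le_cycleCount {n : ℕ} (hn : 1 ≤ n) (σ : Equiv.Perm (Fin n)) : 1 ≤ cycleCount σ := by
  have : Nonempty (Quotient (Equiv.Perm.SameCycle.setoid σ)) := ⟨Quotient.mk _ ⟨0, hn⟩⟩
  rw [← card_quotient_sameCycle]
  exact Nat.card_pos

theorem one_le_card_parts {n : ℕ} (hn : 1 ≤ n) (π : Finpartition (univ : Finset (Fin n))) :
    1 ≤ #π.parts :=
  card_pos.mpr ⟨_, π.part_mem.mpr (mem_univ ⟨0, hn⟩)⟩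

/-- **Equation (5)**: `∑_{p ≥ 1} k^n_p ∏ xᵢ^{pᵢ} = ∑_{p ≥ 1} |C^n(p)| ∏ (xᵢ)_{pᵢ}` where
`(x)_p` is the falling factorial. -/
theorem genseries_factorizations_eq_genseries_partitioned_cacti
    (n r : ℕ) (hn : 1 ≤ n) (hr : 1 ≤ r) (x : Fin r → ℕ) :
    ∑ᶠ (p : Fin r → ℕ) (_ : ∀ i, 1 ≤ p i),
        numFactorizations n r p * ∏ i, x i ^ p i
      = ∑ᶠ (p : Fin r → ℕ) (_ : ∀ i, 1 ≤ p i),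
          Nat.card (PartitionedCacti n r p) * ∏ i, (x i).descFactorial (p i) := by
  have hleft (p : Fin r → ℕ) : numFactorizations n r p =
      Nat.card {α : Fin r → Equiv.Perm (Fin n) //
        (List.ofFn α).prod = finRotate n ∧ (fun i ↦ cycleCount (α i)) = p} := by
    simp only [numFactorizations, funext_iff]
  have hright (p : Fin r → ℕ) : Nat.card (PartitionedCacti n r p) =
      Nat.card {c : (Fin r → Equiv.Perm (Fin n)) ×
          (Fin r → Finpartition (Finset.univ : Finset (Fin n))) //
        ((List.ofFn c.1).prod = finRotate n ∧
          ∀ i : Fin r, ∀ b ∈ (c.2 i).parts, ∀ v ∈ b, c.1 i v ∈ b) ∧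
        (fun i ↦ #(c.2 i).parts) = p} :=
    Nat.card_congr <| Equiv.subtypeEquivRight fun c ↦ by rw [funext_iff]; tauto
  simp_rw [hleft, hright]
  rw [finsum_card_fiber_mul (fun α : Fin r → Equiv.Perm (Fin n) ↦ (List.ofFn α).prod = finRotate n)
      (fun α i ↦ cycleCount (α i)) (fun p ↦ ∀ i, 1 ≤ p i)
      (fun α _ i ↦ one_le_cycleCount hn (α i)) fun p ↦ ∏ i, x i ^ p i,
    finsum_card_fiber_mul (fun c : (Fin r → Equiv.Perm (Fin n)) ×
          (Fin r → Finpartition (Finset.univ : Finset (Fin n))) ↦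
        (List.ofFn c.1).prod = finRotate n ∧
          ∀ i : Fin r, ∀ b ∈ (c.2 i).parts, ∀ v ∈ b, c.1 i v ∈ b)
      (fun c i ↦ #(c.2 i).parts) (fun p ↦ ∀ i, 1 ≤ p i)
      (fun c _ i ↦ one_le_card_parts hn (c.2 i)) fun p ↦ ∏ i, (x i).descFactorial (p i)]
  simp_rw [pow_cycleCount_eq_sum_descFactorial, prod_univ_sum]
  rw [sum_sigma']
  refine sum_nbij' (fun c ↦ (c.1, c.2)) (fun c ↦ ⟨c.1, c.2⟩) ?_ ?_ ?_ ?_ ?_ <;>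
    simp +contextual [Fintype.mem_piFinset]
end

section
/- Let n ≥ 1 and p₁, p₂, p₃ ≥ 1 be integers and let a₁, a₂, a₃ be non-negative integers such that the seven quantities a₁, a₂, a₃, p₁−1−a₂−a₃, p₂−a₃−a₁, p₃−a₁−a₂, and n+1+a₁+a₂+a₃−p₁−p₂−p₃ are all non-negative. Then, with M denoting the extended multinomial coefficient, (p₂p₃ − a₃(p₃ − a₁)) · M(n; a₁, a₂, a₃, p₁−1−a₂−a₃, p₂−a₃−a₁, p₃−a₁−a₂, n+1+a₁+a₂+a₃−p₁−p₂−p₃) = n·(n+2+a₁+a₂+a₃−p₁−p₂−p₃) · M(n−1; a₁, a₂, a₃, p₁−1−a₂−a₃, p₂−1−a₃−a₁, p₃−1−a₁−a₂, n+2+a₁+a₂+a₃−p₁−p₂−p₃) + n·(p₁−a₃−a₂) · M(n−1; a₁, a₂−1, a₃, p₁−a₂−a₃, p₂−1−a₃−a₁, p₃−a₁−a₂, n+1+a₁+a₂+a₃−p₁−p₂−p₃) + n·(p₂+p₃−a₁) · M(n−1; a₁−1, a₂, a₃, p₁−1−a₂−a₃, p₂−a₃−a₁, p₃−a₁−a₂,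 n+1+a₁+a₂+a₃−p₁−p₂−p₃). -/
open Finset

/-- The extended multinomial coefficient `M(N; b₁,…,b₇)`: equal to `N!/(b₁!⋯b₇!)` if all the
`b j` are non-negative and sum to `N`, and to `0` otherwise. -/
def extM (N : ℕ) (b : Fin 7 → ℤ) : ℤ :=
  if (∀ j, 0 ≤ b j) ∧ (∑ j, b j) = (N : ℤ) then
    (Nat.multinomial Finset.univ (fun j => (b j).toNat) : ℤ)
  else 0

/-- The reciprocal factorial `1 / z!` of an integer, equal to `0` for negative `z`. -/
def invFactorial (z : ℤ) : ℚ :=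
  if 0 ≤ z then (z.toNat.factorial : ℚ)⁻¹ else 0

theorem invFactorial_sub_one (z : ℤ) : invFactorial (z - 1) = z * invFactorial z := by
  rcases lt_trichotomy z 0 with hz | rfl | hz
  · simp [invFactorial, show ¬ 0 ≤ z by lia, show ¬ 1 ≤ z by lia]
  · simp [invFactorial]
  · obtain ⟨m, rfl⟩ : ∃ m : ℕ, z = m + 1 := ⟨(z - 1).toNat, by lia⟩
    have hm : ((m : ℤ) + 1).toNat = m + 1 := by lia
    have hm₀ : (0 : ℤ) ≤ m + 1 := by lia
    have hf : (m.factorial : ℚ) ≠ 0 := by exact_mod_cast m.factorial_ne_zero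
    simp only [invFactorial, add_sub_cancel_right, Int.toNat_natCast, Int.natCast_nonneg, hm, hm₀,
      if_true, Nat.factorial_succ]
    push_cast
    field_simp

theorem extM_cast_eq_prod {N : ℕ} {b : Fin 7 → ℤ} (hb : ∑ j, b j = N) :
    (extM N b : ℚ) = N.factorial * ∏ j, invFactorial (b j) := by
  by_cases h : ∀ j, 0 ≤ b j
  · have hsum : ∑ j, (b j).toNat = N := by
      zify
      simpa [h] using hb
    have hspec := Nat.multinomial_spec univ fun j => (b j).toNat
    rw [hsum] at hspec
    have hne : (∏ j, ((b j).toNat.factorial : ℚ)) ≠ 0 :=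
      prod_ne_zero_iff.mpr fun j _ => by exact_mod_cast (b j).toNat.factorial_ne_zero
    simp only [extM, invFactorial, h, hb, implies_true, and_self, if_true, prod_inv_distrib,
      ← hspec]
    push_cast
    field_simp
  · obtain ⟨j, hj⟩ := not_forall.mp h
    rw [prod_eq_zero (mem_univ j) (by simp [invFactorial, hj])]
    simp [extM, h]

/-- **Key summand identity for the case `r = 3`** relating the summand of the main formula
(with determinant value `p₂p₃ - a₃(p₃ - a₁)`) to summands of Jackson's formula. -/
theorem r_eq_three_summand_identity
    (n p₁ p₂ p₃ a₁ a₂ a₃ : ℕ) (hn : 1 ≤ n)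
    (hp₁ : 1 ≤ p₁) (hp₂ : 1 ≤ p₂) (hp₃ : 1 ≤ p₃)
    (h4 : 0 ≤ (p₁ : ℤ) - 1 - a₂ - a₃)
    (h5 : 0 ≤ (p₂ : ℤ) - a₃ - a₁)
    (h6 : 0 ≤ (p₃ : ℤ) - a₁ - a₂)
    (h7 : 0 ≤ (n : ℤ) + 1 + a₁ + a₂ + a₃ - p₁ - p₂ - p₃) :
    ((p₂ : ℤ) * p₃ - (a₃ : ℤ) * ((p₃ : ℤ) - a₁)) *
        extM n ![(a₁ : ℤ), (a₂ : ℤ), (a₃ : ℤ), (p₁ : ℤ) - 1 - a₂ - a₃,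
          (p₂ : ℤ) - a₃ - a₁, (p₃ : ℤ) - a₁ - a₂,
          (n : ℤ) + 1 + a₁ + a₂ + a₃ - p₁ - p₂ - p₃]
      = (n : ℤ) * ((n : ℤ) + 2 + a₁ + a₂ + a₃ - p₁ - p₂ - p₃) *
          extM (n - 1) ![(a₁ : ℤ), (a₂ : ℤ), (a₃ : ℤ), (p₁ : ℤ) - 1 - a₂ - a₃,
            (p₂ : ℤ) - 1 - a₃ - a₁, (p₃ : ℤ) - 1 - a₁ - a₂,
            (n : ℤ) + 2 + a₁ + a₂ + a₃ - p₁ - p₂ - p₃]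
        + (n : ℤ) * ((p₁ : ℤ) - a₃ - a₂) *
          extM (n - 1) ![(a₁ : ℤ), (a₂ : ℤ) - 1, (a₃ : ℤ), (p₁ : ℤ) - a₂ - a₃,
            (p₂ : ℤ) - 1 - a₃ - a₁, (p₃ : ℤ) - a₁ - a₂,
            (n : ℤ) + 1 + a₁ + a₂ + a₃ - p₁ - p₂ - p₃]
        + (n : ℤ) * ((p₂ : ℤ) + p₃ - a₁) *
          extM (n - 1) ![(a₁ : ℤ) - 1, (a₂ : ℤ), (a₃ : ℤ), (p₁ : ℤ) - 1 - a₂ - a₃,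
            (p₂ : ℤ) - a₃ - a₁, (p₃ : ℤ) - a₁ - a₂,
            (n : ℤ) + 1 + a₁ + a₂ + a₃ - p₁ - p₂ - p₃] := by
  rw [← Int.cast_inj (α := ℚ)]
  obtain ⟨m, rfl⟩ : ∃ m, n = m + 1 := ⟨n - 1, by lia⟩
  push_cast
  rw [extM_cast_eq_prod, extM_cast_eq_prod, extM_cast_eq_prod, extM_cast_eq_prod]
  · simp only [Fin.prod_univ_seven, Nat.factorial_succ, Matrix.cons_val]
    set c₄ : ℤ := p₁ - a₂ - a₃ with hc₄
    set c₅ : ℤ := p₂ - a₃ - a₁ with hc₅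
    set c₆ : ℤ := p₃ - a₁ - a₂ with hc₆
    set c₇ : ℤ := m + 1 + 2 + a₁ + a₂ + a₃ - p₁ - p₂ - p₃ with hc₇
    rw [show (p₁ : ℤ) - 1 - a₂ - a₃ = c₄ - 1 by lia, show (p₂ : ℤ) - 1 - a₃ - a₁ = c₅ - 1 by lia,
      show (p₃ : ℤ) - 1 - a₁ - a₂ = c₆ - 1 by lia,
      show (m : ℤ) + 1 + 1 + a₁ + a₂ + a₃ - p₁ - p₂ - p₃ = c₇ - 1 by lia]
    simp only [invFactorial_sub_one]
    simp only [hc₄, hc₅, hc₆, hc₇]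
    push_cast
    ring
  all_goals
    simp only [Fin.sum_univ_seven, Matrix.cons_val]
    lia
end
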